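/- arXiv:1306.1258 — 2 statements merged into one kernel-verified Lean document; each statement's English description precedes it below -/
import Mathlib

section
/- Let V be a finite-dimensional complex inner product space and let H : [0, s] → (self-adjoint operators on V) be continuously differentiable, for some s ≥ 0. Suppose the lowest eigenvalue E0(0) of H(0) is simple, and let Δ(0) > 0 be the distance from E0(0) to the rest of the spectrum of H(0). Let r ∈ [0, s] and suppose Δ(0) − 2 r · sup_{θ∈[0,r]} ‖∂_θ H(θ)‖ > 0. Then the lowest eigenvalue of H(r) is simple, and its distance Δ(r) to the rest of the spectrum of H(r) satisfies Δ(r) ≥ Δ(0) − 2 r · sup_{θ∈[0,r]} ‖∂_θ H(θ)‖. -/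
lemma quad_lower {V : Type*} [NormedAddCommGroup V] [InnerProductSpace ℂ V]
    [FiniteDimensional ℂ V] (T : V →ₗ[ℂ] V) (hT : T.IsSymmetric) (c : ℝ) (x : V)
    (h : ∀ i : Fin (Module.finrank ℂ V), c ≤ hT.eigenvalues rfl i ∨
      inner ℂ (hT.eigenvectorBasis rfl i) x = 0) :
    c * ‖x‖ ^ 2 ≤ (inner ℂ x (T x)).re := by
  have h1 := (hT.eigenvectorBasis rfl).sum_inner_mul_inner x (T x)
  have h2 := (hT.eigenvectorBasis rfl).sum_sq_norm_inner_right x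
  rw [← h1, ← h2, Finset.mul_sum, Complex.re_sum]
  refine Finset.sum_le_sum fun i _ => ?_
  have h3 : inner ℂ (hT.eigenvectorBasis rfl i) (T x)
      = (hT.eigenvalues rfl i : ℂ) * inner ℂ (hT.eigenvectorBasis rfl i) x := by
    rw [← hT, hT.apply_eigenvectorBasis, inner_smul_left]
    simp
  have h4 : inner ℂ x (hT.eigenvectorBasis rfl i) *
      inner ℂ (hT.eigenvectorBasis rfl i) (T x)
      = ((hT.eigenvalues rfl i * ‖inner ℂ (hT.eigenvectorBasis rfl i) x‖ ^ 2 : ℝ) : ℂ) := by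
    rw [h3, ← inner_conj_symm x]
    push_cast
    rw [← Complex.conj_mul']
    ring
  rw [h4, Complex.ofReal_re]
  rcases h i with h | h
  · gcongr
  · simp [h]

lemma gap_aux {V : Type*} [NormedAddCommGroup V] [InnerProductSpace ℂ V]
    [FiniteDimensional ℂ V] [Nontrivial V] (A B : V →L[ℂ] V)
    (hA : (A : V →ₗ[ℂ] V).IsSymmetric) (hB : (B : V →ₗ[ℂ] V).IsSymmetric) (δ : ℝ)
    (hδ : ‖B - A‖ ≤ δ) (E0 Δ0 : ℝ)
    (hE0eig : ∃ v : V, v ≠ 0 ∧ A v = (E0 : ℂ) • v)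
    (hE0simple :
      Module.finrank ℂ (Module.End.eigenspace (A : V →ₗ[ℂ] V) (E0 : ℂ)) = 1)
    (hgap0 : ∀ μ : ℝ, (∃ v : V, v ≠ 0 ∧ A v = (μ : ℂ) • v) → μ = E0 ∨ E0 + Δ0 ≤ μ)
    (hpos : 0 < Δ0 - 2 * δ) :
    ∃ E0r : ℝ,
      (∃ v : V, v ≠ 0 ∧ B v = (E0r : ℂ) • v) ∧
      (∀ μ : ℝ, (∃ v : V, v ≠ 0 ∧ B v = (μ : ℂ) • v) → E0r ≤ μ) ∧
      Module.finrank ℂ (Module.End.eigenspace (B : V →ₗ[ℂ] V) (E0r : ℂ)) = 1 ∧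
      (∀ μ : ℝ, (∃ v : V, v ≠ 0 ∧ B v = (μ : ℂ) • v) → μ ≠ E0r →
        E0r + (Δ0 - 2 * δ) ≤ μ) := by
  have hfr : 0 < Module.finrank ℂ V := Module.finrank_pos
  haveI : Nonempty (Fin (Module.finrank ℂ V)) := ⟨⟨0, hfr⟩⟩
  obtain ⟨i0, hi0⟩ := Finite.exists_min (hB.eigenvalues rfl)
  set Er := hB.eigenvalues rfl i0 with hEr
  set w : V := hB.eigenvectorBasis rfl i0 with hw
  have hBw : B w = (Er : ℂ) • w := hB.apply_eigenvectorBasis rfl i0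
  have hwn : ‖w‖ = 1 := (hB.eigenvectorBasis rfl).orthonormal.1 i0
  have hw0 : w ≠ 0 := by intro h; simp [h] at hwn
  have hlow : ∀ x : V, Er * ‖x‖ ^ 2 ≤ (inner ℂ x (B x)).re := fun x =>
    quad_lower (B : V →ₗ[ℂ] V) hB Er x fun i => Or.inl (hi0 i)
  have heig : ∀ (T : V →L[ℂ] V) (μ : ℝ) (v : V), T v = (μ : ℂ) • v →
      (inner ℂ v (T v)).re = μ * ‖v‖ ^ 2 := by
    intro T μ v h
    rw [h, inner_smul_right, inner_self_eq_norm_sq_to_K, Complex.re_ofReal_mul]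
    norm_cast
  have hdiff : ∀ x : V, |(inner ℂ x (B x)).re - (inner ℂ x (A x)).re| ≤ δ * ‖x‖ ^ 2 := by
    intro x
    have e : (inner ℂ x (B x)).re - (inner ℂ x (A x)).re = (inner ℂ x ((B - A) x)).re := by
      simp [inner_sub_right]
    rw [e]
    calc _ ≤ ‖inner ℂ x ((B - A) x)‖ := Complex.abs_re_le_norm _
      _ ≤ ‖x‖ * ‖(B - A) x‖ := norm_inner_le_norm _ _
      _ ≤ ‖x‖ * (δ * ‖x‖) := by
        gcongr
        exact (B - A).le_of_opNorm_le hδ x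
      _ = _ := by ring
  obtain ⟨v0, hv0, hAv0⟩ := hE0eig
  have hErle : Er ≤ E0 + δ := by
    have h1 := hlow v0
    have h2 := hdiff v0
    rw [heig A E0 v0 hAv0] at h2
    have h3 := (abs_le.1 h2).2
    have h4 : 0 < ‖v0‖ ^ 2 := by positivity
    nlinarith
  have hAperp : ∀ x : V, inner ℂ v0 x = 0 → (E0 + Δ0) * ‖x‖ ^ 2 ≤ (inner ℂ x (A x)).re := by
    intro x hx
    refine quad_lower (A : V →ₗ[ℂ] V) hA _ x fun i => ?_
    have hb : A (hA.eigenvectorBasis rfl i) = (hA.eigenvalues rfl i : ℂ) •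
      (hA.eigenvectorBasis rfl i) := hA.apply_eigenvectorBasis rfl i
    have hb0 : hA.eigenvectorBasis rfl i ≠ 0 := (hA.eigenvectorBasis rfl).orthonormal.ne_zero i
    rcases hgap0 _ ⟨_, hb0, hb⟩ with h | h
    · right
      rw [h] at hb
      have hm0 : v0 ∈ Module.End.eigenspace (A : V →ₗ[ℂ] V) (E0 : ℂ) :=
        Module.End.mem_eigenspace_iff.2 hAv0
      have hmb : hA.eigenvectorBasis rfl i ∈ Module.End.eigenspace (A : V →ₗ[ℂ] V) (E0 : ℂ) :=
        Module.End.mem_eigenspace_iff.2 hb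
      obtain ⟨c, hc⟩ := exists_smul_eq_of_finrank_eq_one hE0simple
        (x := ⟨v0, hm0⟩) (by simpa using hv0) ⟨_, hmb⟩
      have hc' : c • v0 = hA.eigenvectorBasis rfl i := congrArg Subtype.val hc
      rw [← hc', inner_smul_left, hx, mul_zero]
    · exact Or.inl h
  -- key estimate
  have key : ∀ (μ : ℝ) (u : V), u ≠ 0 → B u = (μ : ℂ) • u → inner ℂ w u = 0 →
      Er + (Δ0 - 2 * δ) ≤ μ := by
    intro μ u hu hBu hwu
    have hErμ : Er ≤ μ := by
      have h1 := hlow u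
      rw [heig B μ u hBu] at h1
      exact le_of_mul_le_mul_right h1 (by positivity)
    obtain ⟨a, b, hab, hperp⟩ : ∃ a b : ℂ, (a ≠ 0 ∨ b ≠ 0) ∧
        inner ℂ v0 (a • w + b • u) = 0 := by
      by_cases h : inner ℂ v0 w = 0
      · exact ⟨1, 0, Or.inl one_ne_zero, by simp [h]⟩
      · refine ⟨- inner ℂ v0 u, inner ℂ v0 w, Or.inr h, ?_⟩
        rw [inner_add_right, inner_smul_right, inner_smul_right]
        ring
    have huw : inner ℂ u w = 0 := inner_eq_zero_symm.1 hwu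
    set x := a • w + b • u with hx
    have hnx : ‖x‖ ^ 2 = ‖a‖ ^ 2 * ‖w‖ ^ 2 + ‖b‖ ^ 2 * ‖u‖ ^ 2 := by
      have := norm_add_sq_eq_norm_sq_add_norm_sq_of_inner_eq_zero (𝕜 := ℂ) (a • w) (b • u)
        (by simp [inner_smul_left, inner_smul_right, hwu])
      rw [norm_smul, norm_smul] at this
      rw [hx, sq, this]
      ring
    have hqx : (inner ℂ x (B x)).re = Er * (‖a‖ ^ 2 * ‖w‖ ^ 2) + μ * (‖b‖ ^ 2 * ‖u‖ ^ 2) := by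
      have e : inner ℂ x (B x) = ((Er * (‖a‖ ^ 2 * ‖w‖ ^ 2) + μ * (‖b‖ ^ 2 * ‖u‖ ^ 2) : ℝ) : ℂ) := by
        rw [hx, map_add, map_smul, map_smul, hBw, hBu]
        simp only [inner_add_left, inner_add_right, inner_smul_left, inner_smul_right, hwu, huw,
          inner_self_eq_norm_sq_to_K]
        push_cast
        rw [← Complex.conj_mul' a, ← Complex.conj_mul' b]
        simp only [Complex.coe_algebraMap]
        ring
      rw [e, Complex.ofReal_re]
    have hxpos : 0 < ‖x‖ ^ 2 := by
      rw [hnx]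
      rcases hab with h | h
      · have : 0 < ‖a‖ ^ 2 * ‖w‖ ^ 2 := by positivity
        positivity
      · have : 0 < ‖b‖ ^ 2 * ‖u‖ ^ 2 := by positivity
        positivity
    have h1 := hAperp x hperp
    have h2 := (abs_le.1 (hdiff x)).1
    have h3 : (inner ℂ x (B x)).re ≤ μ * ‖x‖ ^ 2 := by
      rw [hqx, hnx, mul_add]
      gcongr
    have h4 : (E0 + Δ0 - δ) * ‖x‖ ^ 2 ≤ μ * ‖x‖ ^ 2 := by linarith
    have h5 := le_of_mul_le_mul_right h4 hxpos
    linarith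
  refine ⟨Er, ⟨w, hw0, hBw⟩, ?_, ?_, ?_⟩
  · rintro μ ⟨u, hu, hBu⟩
    have h1 := hlow u
    rw [heig B μ u hBu] at h1
    exact le_of_mul_le_mul_right h1 (by positivity)
  · have hmw : w ∈ Module.End.eigenspace (B : V →ₗ[ℂ] V) (Er : ℂ) :=
      Module.End.mem_eigenspace_iff.2 hBw
    refine finrank_eq_one (⟨w, hmw⟩ : Module.End.eigenspace (B : V →ₗ[ℂ] V) (Er : ℂ))
      (by simpa using hw0) ?_
    rintro ⟨y, hy⟩
    have hBy : B y = (Er : ℂ) • y := Module.End.mem_eigenspace_iff.1 hy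
    refine ⟨inner ℂ w y, Subtype.ext ?_⟩
    change inner ℂ w y • w = y
    by_contra hne
    have := key Er (y - inner ℂ w y • w) (sub_ne_zero.2 (Ne.symm hne))
      (by rw [map_sub, map_smul, hBy, hBw, smul_sub, smul_comm])
      (by rw [inner_sub_right, inner_smul_right, inner_self_eq_norm_sq_to_K, hwn]; simp)
    linarith
  · rintro μ ⟨u, hu, hBu⟩ hne
    refine key μ u hu hBu ?_
    have h1 : inner ℂ (B w) u = inner ℂ w (B u) := hB w u
    rw [hBw, hBu, inner_smul_left, inner_smul_right, Complex.conj_ofReal] at h1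
    have h2 : ((Er : ℂ) - μ) * inner ℂ w u = 0 := by rw [sub_mul, h1, sub_self]
    rcases mul_eq_zero.1 h2 with h | h
    · exact absurd (Complex.ofReal_injective (sub_eq_zero.1 h)).symm hne
    · exact h

/-- Along a continuously differentiable path `θ ↦ H(θ)` of self-adjoint
operators whose initial lowest eigenvalue `E0` is simple with spectral gap `Δ0 > 0`,
if `Δ0 - 2 r · sup_{θ∈[0,r]} ‖H'(θ)‖ > 0` then the lowest eigenvalue of `H r` is simple
and its spectral gap is at least `Δ0 - 2 r · sup_{θ∈[0,r]} ‖H'(θ)‖`. -/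
theorem gap_estimate_along_path
    {V : Type*} [NormedAddCommGroup V] [InnerProductSpace ℂ V] [FiniteDimensional ℂ V]
    [Nontrivial V]
    (s : ℝ) (hs : 0 ≤ s)
    (H H' : ℝ → V →L[ℂ] V)
    (hsa : ∀ θ ∈ Set.Icc 0 s, IsSelfAdjoint (H θ))
    (hderiv : ∀ θ ∈ Set.Icc 0 s, HasDerivWithinAt H (H' θ) (Set.Icc 0 s) θ)
    (hcont : ContinuousOn H' (Set.Icc 0 s))
    (E0 Δ0 : ℝ)
    (hE0eig : ∃ v : V, v ≠ 0 ∧ H 0 v = (E0 : ℂ) • v)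
    (hE0low : ∀ μ : ℝ, (∃ v : V, v ≠ 0 ∧ H 0 v = (μ : ℂ) • v) → E0 ≤ μ)
    (hE0simple :
      Module.finrank ℂ (Module.End.eigenspace (H 0 : V →ₗ[ℂ] V) (E0 : ℂ)) = 1)
    (hΔ0 : 0 < Δ0)
    (hgap0 : ∀ μ : ℝ, (∃ v : V, v ≠ 0 ∧ H 0 v = (μ : ℂ) • v) → μ = E0 ∨ E0 + Δ0 ≤ μ)
    (r : ℝ) (hr : r ∈ Set.Icc 0 s)
    (hpos : 0 < Δ0 - 2 * r * sSup ((fun θ => ‖H' θ‖) '' Set.Icc 0 r)) :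
    ∃ E0r : ℝ,
      (∃ v : V, v ≠ 0 ∧ H r v = (E0r : ℂ) • v) ∧
      (∀ μ : ℝ, (∃ v : V, v ≠ 0 ∧ H r v = (μ : ℂ) • v) → E0r ≤ μ) ∧
      Module.finrank ℂ (Module.End.eigenspace (H r : V →ₗ[ℂ] V) (E0r : ℂ)) = 1 ∧
      (∀ μ : ℝ, (∃ v : V, v ≠ 0 ∧ H r v = (μ : ℂ) • v) → μ ≠ E0r →
        E0r + (Δ0 - 2 * r * sSup ((fun θ => ‖H' θ‖) '' Set.Icc 0 r)) ≤ μ) := by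
  have h0s : (0 : ℝ) ∈ Set.Icc 0 s := ⟨le_rfl, hs⟩
  have hsub : Set.Icc 0 r ⊆ Set.Icc 0 s := Set.Icc_subset_Icc_right hr.2
  have hbdd : BddAbove ((fun θ => ‖H' θ‖) '' Set.Icc 0 r) :=
    (isCompact_Icc.image_of_continuousOn (hcont.mono hsub).norm).bddAbove
  have hdiff : ‖H r - H 0‖ ≤ r * sSup ((fun θ => ‖H' θ‖) '' Set.Icc 0 r) := by
    have := (convex_Icc (0 : ℝ) r).norm_image_sub_le_of_norm_hasDerivWithin_le
      (f := H) (f' := H') (x := 0) (y := r)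
      (fun θ hθ => (hderiv θ (hsub hθ)).mono hsub)
      (fun θ hθ => le_csSup hbdd (Set.mem_image_of_mem _ hθ))
      ⟨le_rfl, hr.1⟩ ⟨hr.1, le_rfl⟩
    rw [sub_zero, Real.norm_of_nonneg hr.1, mul_comm] at this
    exact this
  rw [mul_assoc] at hpos ⊢
  exact gap_aux (H 0) (H r) (hsa 0 h0s).isSymmetric (hsa r hr).isSymmetric _ hdiff E0 Δ0
    hE0eig hE0simple hgap0 hpos
end

section
/- Let V be a finite-dimensional complex inner product space and let ψ : [0, r] × [0, r] → V be a twice continuously differentiable family of unit vectors. Define the real phases φ1, φ2, φ3, φ4 by i φ1 = −∫₀^r ⟨ψ(t, 0), ∂_x ψ(t, 0)⟩ dt, i φ2 = −∫₀^r ⟨ψ(r, t), ∂_y ψ(r, t)⟩ dt, i φ3 = ∫₀^r ⟨ψ(t, r), ∂_x ψ(t, r)⟩ dt, i φ4 = ∫₀^r ⟨ψ(0, t), ∂_y ψ(0, t)⟩ dt (each ⟨ψ, ∂ψ⟩ is purely imaginary since ‖ψ‖ = 1, so the φ_i are real). Then φ1 + φ2 + φ3 + φ4 = 2 ∫₀^r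 ∫₀^r Im ⟨∂_y ψ(x, y), ∂_x ψ(x, y)⟩ dx dy. -/
open scoped ComplexInnerProductSpace

/-- Stokes' theorem for the Berry phase: the sum of the four boundary
phases of a twice continuously differentiable family of unit vectors over the square
`[0,r] × [0,r]` equals `2 ∬ Im ⟪∂_y ψ, ∂_x ψ⟫`. -/
theorem berry_phase_stokes
    {V : Type*} [NormedAddCommGroup V] [InnerProductSpace ℂ V] [FiniteDimensional ℂ V]
    (r : ℝ) (hr : 0 ≤ r) (ψ : ℝ × ℝ → V)
    (hψ : ContDiff ℝ 2 ψ)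
    (hunit : ∀ p ∈ Set.Icc (0:ℝ) r ×ˢ Set.Icc (0:ℝ) r, ‖ψ p‖ = 1)
    (φ1 φ2 φ3 φ4 : ℝ)
    (hφ1 : Complex.I * (φ1 : ℂ)
      = -∫ t in (0:ℝ)..r, ⟪ψ (t, 0), fderiv ℝ ψ (t, 0) ((1:ℝ), (0:ℝ))⟫)
    (hφ2 : Complex.I * (φ2 : ℂ)
      = -∫ t in (0:ℝ)..r, ⟪ψ (r, t), fderiv ℝ ψ (r, t) ((0:ℝ), (1:ℝ))⟫)
    (hφ3 : Complex.I * (φ3 : ℂ)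
      = ∫ t in (0:ℝ)..r, ⟪ψ (t, r), fderiv ℝ ψ (t, r) ((1:ℝ), (0:ℝ))⟫)
    (hφ4 : Complex.I * (φ4 : ℂ)
      = ∫ t in (0:ℝ)..r, ⟪ψ (0, t), fderiv ℝ ψ (0, t) ((0:ℝ), (1:ℝ))⟫) :
    φ1 + φ2 + φ3 + φ4 =
      2 * ∫ x in (0:ℝ)..r, ∫ y in (0:ℝ)..r,
        (⟪fderiv ℝ ψ (x, y) ((0:ℝ), (1:ℝ)), fderiv ℝ ψ (x, y) ((1:ℝ), (0:ℝ))⟫).im := by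
  have hd : ∀ p, HasFDerivAt ψ (fderiv ℝ ψ p) p := fun p =>
    (hψ.differentiable (by norm_num) p).hasFDerivAt
  have h1 : ContDiff ℝ 1 (fderiv ℝ ψ) := hψ.fderiv_right (by norm_num)
  have hdd : ∀ p, HasFDerivAt (fderiv ℝ ψ) (fderiv ℝ (fderiv ℝ ψ) p) p := fun p =>
    (h1.differentiable (by norm_num) p).hasFDerivAt
  have hc0 : Continuous ψ := hψ.continuous
  have hc1 : Continuous (fderiv ℝ ψ) := h1.continuous
  have hsym : ∀ p v w, fderiv ℝ (fderiv ℝ ψ) p v w = fderiv ℝ (fderiv ℝ ψ) p w v := by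
    intro p v w
    exact (hψ.contDiffAt.isSymmSndFDerivAt (by simp)) v w
  have hD : ∀ v p, HasFDerivAt (fun q => ⟪ψ q, fderiv ℝ ψ q v⟫)
      ((fderivInnerCLM ℂ (ψ p, fderiv ℝ ψ p v)).comp
        ((fderiv ℝ ψ p).prod ((fderiv ℝ (fderiv ℝ ψ) p).flip v))) p := by
    intro v p
    have h2 : HasFDerivAt (fun q => fderiv ℝ ψ q v) ((fderiv ℝ (fderiv ℝ ψ) p).flip v) p := by
      simpa using (hdd p).clm_apply (hasFDerivAt_const v p)
    exact (hd p).inner ℂ h2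
  set F : ℝ × ℝ → ℂ := fun q => ⟪ψ q, fderiv ℝ ψ q ((0:ℝ), (1:ℝ))⟫ with hF
  set G : ℝ × ℝ → ℂ := fun q => ⟪ψ q, fderiv ℝ ψ q ((1:ℝ), (0:ℝ))⟫ with hG
  set K : ℝ × ℝ → ℝ := fun q =>
    (⟪fderiv ℝ ψ q ((0:ℝ), (1:ℝ)), fderiv ℝ ψ q ((1:ℝ), (0:ℝ))⟫).im with hK
  have hKc : Continuous K := by
    apply Complex.continuous_im.comp
    exact (hc1.clm_apply continuous_const).inner (hc1.clm_apply continuous_const)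
  have hFc : Continuous F := hc0.inner (hc1.clm_apply continuous_const)
  have hGc : Continuous G := hc0.inner (hc1.clm_apply continuous_const)
  have key : ∀ p, (-((fderivInnerCLM ℂ (ψ p, fderiv ℝ ψ p ((0:ℝ), (1:ℝ)))).comp
        ((fderiv ℝ ψ p).prod ((fderiv ℝ (fderiv ℝ ψ) p).flip ((0:ℝ), (1:ℝ)))))) ((1:ℝ), (0:ℝ))
      + ((fderivInnerCLM ℂ (ψ p, fderiv ℝ ψ p ((1:ℝ), (0:ℝ)))).comp
        ((fderiv ℝ ψ p).prod ((fderiv ℝ (fderiv ℝ ψ) p).flip ((1:ℝ), (0:ℝ))))) ((0:ℝ), (1:ℝ))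
      = Complex.I * ((2 * K p : ℝ) : ℂ) := by
    intro p
    simp only [neg_apply, ContinuousLinearMap.comp_apply,
      ContinuousLinearMap.prod_apply, fderivInnerCLM_apply, ContinuousLinearMap.flip_apply, hK]
    rw [hsym p ((0:ℝ), (1:ℝ)) ((1:ℝ), (0:ℝ)),
      ← inner_conj_symm (fderiv ℝ ψ p ((1:ℝ), (0:ℝ))) (fderiv ℝ ψ p ((0:ℝ), (1:ℝ)))]
    generalize ⟪fderiv ℝ ψ p ((0:ℝ), (1:ℝ)), fderiv ℝ ψ p ((1:ℝ), (0:ℝ))⟫ = z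
    generalize ⟪ψ p, _⟫ = w
    apply Complex.ext
    · simp only [Complex.add_re, Complex.neg_re, Complex.conj_re, Complex.mul_re, Complex.I_re,
        Complex.I_im, Complex.ofReal_re, Complex.ofReal_im]
      ring
    · simp only [Complex.add_im, Complex.neg_im, Complex.conj_im, Complex.mul_im, Complex.I_re,
        Complex.I_im, Complex.ofReal_re, Complex.ofReal_im]
      ring
  have main := MeasureTheory.integral2_divergence_prod_of_hasFDerivAt (fun q => -F q) G
    (fun p => -((fderivInnerCLM ℂ (ψ p, fderiv ℝ ψ p ((0:ℝ), (1:ℝ)))).comp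
        ((fderiv ℝ ψ p).prod ((fderiv ℝ (fderiv ℝ ψ) p).flip ((0:ℝ), (1:ℝ))))))
    (fun p => (fderivInnerCLM ℂ (ψ p, fderiv ℝ ψ p ((1:ℝ), (0:ℝ)))).comp
        ((fderiv ℝ ψ p).prod ((fderiv ℝ (fderiv ℝ ψ) p).flip ((1:ℝ), (0:ℝ)))))
    0 0 r r hFc.neg.continuousOn hGc.continuousOn (fun p _ => (hD ((0:ℝ), (1:ℝ)) p).neg) (fun p _ => hD ((1:ℝ), (0:ℝ)) p) (by
      simp only [key]
      refine ContinuousOn.integrableOn_compact (isCompact_uIcc.prod isCompact_uIcc) ?_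
      exact (continuous_const.mul (Complex.continuous_ofReal.comp
        (continuous_const.mul hKc))).continuousOn)
  simp only [key, intervalIntegral.integral_const_mul, intervalIntegral.integral_ofReal,
    intervalIntegral.integral_neg] at main
  have e : Complex.I * ((φ1 + φ2 + φ3 + φ4 : ℝ) : ℂ)
      = Complex.I * ((2 * ∫ x in (0:ℝ)..r, ∫ y in (0:ℝ)..r, K (x, y) : ℝ) : ℂ) := by
    rw [main]
    push_cast
    simp only [mul_add, hφ1, hφ2, hφ3, hφ4, hF, hG]
    ring
  exact_mod_cast mul_left_cancel₀ Complex.I_ne_zero e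
end
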